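/- Let (M,g,J) be a 6-dimensional strict nearly Kähler manifold with scal = 30, {e_i} a local orthonormal frame of TM, and A_X := J(∇_X J). Then: (i) Σ_i e_i ∧ (A_{e_i⋆}w) = 0 and (ii) Σ_i e_i ⌟ (A_{e_i⋆}w) = 0 for every w ∈ Λ^{(1,1)}₀M; (iii) Σ_i (A_{e_i⋆}h)(e_i) = 0 for every h ∈ Sym⁺₀M; (iv) Σ_i (A_{e_i⋆}S)(e_i) = 0 for every S ∈ Sym⁻M; (v) Σ_i e_i ⌟ (A_{e_i⋆}(S⋆ψ⁻)) = 0 for every S ∈ Sym⁻M. -/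

import Mathlib

open scoped BigOperators

noncomputable section

/-!  An abstract model of the global-analytic data of a 6-dimensional strict nearly
Kähler spin manifold `(M,g,J)`.

* `Mbase` is the underlying topological space,
* `F` models the commutative ring of smooth (complex valued) functions,
* `V` models the `F`-module of smooth vector fields, equipped with a (local)
  orthonormal frame `e` (indexed by `Fin 6`, so `dim M = 6`),
* `act` is the action of vector fields on functions by derivations,
* `g` is the Riemannian metric, `J` the almost complex structure,
* `nabla` is the Levi-Civita connection (torsion free, metric) and `bracket`
  the Lie bracket of vector fields,
* `Sp` models the (sections of the) spinor bundle `S_{1/2}`, `c` is Clifford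
  multiplication, `nablaS` the spin connection, `innerS` the spinor inner product,
* `nearlyKahler` is the nearly Kähler condition `(∇_X J) X = 0` and `strict`
  says the structure is non-Kähler (`∇J ≠ 0`). -/
structure NK6 where
  Mbase : Type
  [topM : TopologicalSpace Mbase]
  F : Type
  V : Type
  Sp : Type
  [ringF : CommRing F]
  [algF : Algebra ℝ F]
  [grpV : AddCommGroup V]
  [modV : Module F V]
  [modVR : Module ℝ V]
  [towerV : IsScalarTower ℝ F V]
  [grpS : AddCommGroup Sp]
  [modS : Module F Sp]
  [modSR : Module ℝ Sp]
  [towerS : IsScalarTower ℝ F Sp]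
  act : V → Derivation ℝ F F
  act_add : ∀ X Y f, act (X + Y) f = act X f + act Y f
  act_smul : ∀ (f : F) X h, act (f • X) h = f * act X h
  g : V → V → F
  g_add₁ : ∀ X X' Y, g (X + X') Y = g X Y + g X' Y
  g_smul₁ : ∀ (f : F) X Y, g (f • X) Y = f * g X Y
  g_symm : ∀ X Y, g X Y = g Y X
  g_nondeg : ∀ X, (∀ Y, g X Y = 0) → X = 0
  J : V → V
  J_add : ∀ X Y, J (X + Y) = J X + J Y
  J_smul : ∀ (f : F) X, J (f • X) = f • J X
  J_sq : ∀ X, J (J X) = -X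
  J_metric : ∀ X Y, g (J X) (J Y) = g X Y
  nabla : V → V → V
  nabla_add₁ : ∀ X X' Y, nabla (X + X') Y = nabla X Y + nabla X' Y
  nabla_smul₁ : ∀ (f : F) X Y, nabla (f • X) Y = f • nabla X Y
  nabla_add₂ : ∀ X Y Y', nabla X (Y + Y') = nabla X Y + nabla X Y'
  nabla_leibniz : ∀ X (f : F) Y, nabla X (f • Y) = act X f • Y + f • nabla X Y
  nabla_metric : ∀ X Y Z, act X (g Y Z) = g (nabla X Y) Z + g Y (nabla X Z)
  bracket : V → V → V
  act_bracket : ∀ X Y f, act (bracket X Y) f = act X (act Y f) - act Y (act X f)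
  torsion_free : ∀ X Y, nabla X Y - nabla Y X = bracket X Y
  e : Fin 6 → V
  orthonormal : ∀ i j, g (e i) (e j) = if i = j then 1 else 0
  frame_span : ∀ X : V, X = ∑ i, g X (e i) • e i
  nearlyKahler : ∀ X, nabla X (J X) = J (nabla X X)
  strict : ¬ ∀ X Y, nabla X (J Y) = J (nabla X Y)
  c : V → Sp → Sp
  c_add₁ : ∀ X X' s, c (X + X') s = c X s + c X' s
  c_smul₁ : ∀ (f : F) X s, c (f • X) s = f • c X s
  c_add₂ : ∀ X s s', c X (s + s') = c X s + c X s'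
  c_smul₂ : ∀ X (f : F) s, c X (f • s) = f • c X s
  clifford : ∀ X Y s, c X (c Y s) + c Y (c X s) = -((2 : F) • g X Y • s)
  nablaS : V → Sp → Sp
  nablaS_add₁ : ∀ X X' s, nablaS (X + X') s = nablaS X s + nablaS X' s
  nablaS_smul₁ : ∀ (f : F) X s, nablaS (f • X) s = f • nablaS X s
  nablaS_add₂ : ∀ X s s', nablaS X (s + s') = nablaS X s + nablaS X s'
  nablaS_leibniz : ∀ X (f : F) s, nablaS X (f • s) = act X f • s + f • nablaS X s
  nablaS_clifford : ∀ X Y s, nablaS X (c Y s) = c (nabla X Y) s + c Y (nablaS X s)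
  innerS : Sp → Sp → F

attribute [instance] NK6.topM NK6.ringF NK6.algF NK6.grpV NK6.modV NK6.modVR
  NK6.towerV NK6.grpS NK6.modS NK6.modSR NK6.towerS

namespace NK6

variable (M : NK6)

/-- `A_X Y = (J (∇_X J)) Y = J(∇_X (JY)) + ∇_X Y`. -/
def A (X Y : M.V) : M.V := M.J (M.nabla X (M.J Y)) + M.nabla X Y

/-- The canonical Hermitian connection `∇̄_X Y = ∇_X Y - (1/2) A_X Y` on vector fields. -/
def nb (X Y : M.V) : M.V := M.nabla X Y - (1 / 2 : ℝ) • M.A X Y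

/-- The curvature tensor of the Levi-Civita connection. -/
def R (W X Y : M.V) : M.V :=
  M.nabla W (M.nabla X Y) - M.nabla X (M.nabla W Y) - M.nabla (M.bracket W X) Y

/-- The curvature tensor of the canonical Hermitian connection. -/
def Rb (W X Y : M.V) : M.V :=
  M.nb W (M.nb X Y) - M.nb X (M.nb W Y) - M.nb (M.bracket W X) Y

/-- The Ricci curvature `Ric(X,Y) = ∑ᵢ g(R(eᵢ,X)Y,eᵢ)`. -/
def Ric (X Y : M.V) : M.F := ∑ i, M.g (M.R (M.e i) X Y) (M.e i)

/-- The scalar curvature. -/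
def scal : M.F := ∑ j, M.Ric (M.e j) (M.e j)

/-- The Ricci curvature of the canonical Hermitian connection. -/
def Ricb (X Y : M.V) : M.F := ∑ i, M.g (M.Rb (M.e i) X Y) (M.e i)

/-- `Ric̄(X)`, as a vector field (the Hermitian Ricci endomorphism). -/
def RicbVec (X : M.V) : M.V := ∑ j, M.Ricb X (M.e j) • M.e j

/-- The Kähler form `ω = g(J·,·)`. -/
def omegaF (X Y : M.V) : M.F := M.g (M.J X) Y

/-- The 3-form `ψ⁺ = ∇ω`, i.e. `ψ⁺(X,Y,Z) = g((∇_X J)Y, Z)`. -/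
def psiP (X Y Z : M.V) : M.F := M.g (M.nabla X (M.J Y) - M.J (M.nabla X Y)) Z

/-- The Riemannian volume form of the oriented orthonormal frame `e`. -/
def vol6 (Xs : Fin 6 → M.V) : M.F := (Matrix.of fun i j => M.g (Xs i) (M.e j)).det

/-- The Hodge star operator on 3-forms. -/
def star3 (α : M.V → M.V → M.V → M.F) (X Y Z : M.V) : M.F :=
  (1 / 6 : ℝ) • ∑ i, ∑ j, ∑ k,
    α (M.e i) (M.e j) (M.e k) * M.vol6 ![M.e i, M.e j, M.e k, X, Y, Z]

/-- The Hodge star operator from 4-forms to 2-forms. -/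
def star4 (α : M.V → M.V → M.V → M.V → M.F) (X Y : M.V) : M.F :=
  (1 / 24 : ℝ) • ∑ i, ∑ j, ∑ k, ∑ l,
    α (M.e i) (M.e j) (M.e k) (M.e l) * M.vol6 ![M.e i, M.e j, M.e k, M.e l, X, Y]

/-- The 3-form `ψ⁻ = *ψ⁺`. -/
def psiM : M.V → M.V → M.V → M.F := M.star3 M.psiP

/-- Covariant derivative of a 1-form. -/
def D1 (X : M.V) (θ : M.V → M.F) (Y : M.V) : M.F := M.act X (θ Y) - θ (M.nabla X Y)

/-- Covariant derivative of a 2-form. -/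
def D2 (X : M.V) (α : M.V → M.V → M.F) (Y Z : M.V) : M.F :=
  M.act X (α Y Z) - α (M.nabla X Y) Z - α Y (M.nabla X Z)

/-- Covariant derivative of a 3-form. -/
def D3 (X : M.V) (α : M.V → M.V → M.V → M.F) (Y Z W : M.V) : M.F :=
  M.act X (α Y Z W) - α (M.nabla X Y) Z W - α Y (M.nabla X Z) W - α Y Z (M.nabla X W)

/-- Covariant derivative of a 4-form. -/
def D4 (X : M.V) (α : M.V → M.V → M.V → M.V → M.F) (Y Z W U : M.V) : M.F :=
  M.act X (α Y Z W U) - α (M.nabla X Y) Z W U - α Y (M.nabla X Z) W U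
    - α Y Z (M.nabla X W) U - α Y Z W (M.nabla X U)

/-- Hermitian covariant derivative of a 2-form. -/
def Db2 (X : M.V) (α : M.V → M.V → M.F) (Y Z : M.V) : M.F :=
  M.act X (α Y Z) - α (M.nb X Y) Z - α Y (M.nb X Z)

/-- Hermitian covariant derivative of a 3-form. -/
def Db3 (X : M.V) (α : M.V → M.V → M.V → M.F) (Y Z W : M.V) : M.F :=
  M.act X (α Y Z W) - α (M.nb X Y) Z W - α Y (M.nb X Z) W - α Y Z (M.nb X W)

/-- Exterior derivative of a 1-form. -/
def d1 (θ : M.V → M.F) (X Y : M.V) : M.F := M.D1 X θ Y - M.D1 Y θ X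

/-- Exterior derivative of a 2-form. -/
def d2 (α : M.V → M.V → M.F) (X Y Z : M.V) : M.F :=
  M.D2 X α Y Z - M.D2 Y α X Z + M.D2 Z α X Y

/-- Exterior derivative of a 3-form. -/
def d3 (α : M.V → M.V → M.V → M.F) (X Y Z W : M.V) : M.F :=
  M.D3 X α Y Z W - M.D3 Y α X Z W + M.D3 Z α X Y W - M.D3 W α X Y Z

/-- Codifferential of a 2-form. -/
def delta2 (α : M.V → M.V → M.F) (Y : M.V) : M.F := -∑ i, M.D2 (M.e i) α (M.e i) Y

/-- Codifferential of a 3-form. -/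
def delta3 (α : M.V → M.V → M.V → M.F) (Y Z : M.V) : M.F :=
  -∑ i, M.D3 (M.e i) α (M.e i) Y Z

/-- Codifferential of a 4-form. -/
def delta4 (α : M.V → M.V → M.V → M.V → M.F) (Y Z W : M.V) : M.F :=
  -∑ i, M.D4 (M.e i) α (M.e i) Y Z W

/-- The vector field metrically dual to a 1-form. -/
def sharp (θ : M.V → M.F) : M.V := ∑ i, θ (M.e i) • M.e i

/-- Wedge product of a 1-form with a 2-form. -/
def wedge12 (θ : M.V → M.F) (β : M.V → M.V → M.F) (X Y Z : M.V) : M.F :=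
  θ X * β Y Z - θ Y * β X Z + θ Z * β X Y

/-- The natural (derivation) extension `B⋆` of an endomorphism `B` of `TM` to 2-forms. -/
def eAct2 (B : M.V → M.V) (α : M.V → M.V → M.F) (X Y : M.V) : M.F :=
  -α (B X) Y - α X (B Y)

/-- The natural (derivation) extension `B⋆` of an endomorphism `B` of `TM` to 3-forms. -/
def eAct3 (B : M.V → M.V) (α : M.V → M.V → M.V → M.F) (X Y Z : M.V) : M.F :=
  -α (B X) Y Z - α X (B Y) Z - α X Y (B Z)

/-- The modified action `Ã_{B⋆}` on (covariant) 2-tensors: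
`Ã_{B⋆}(α⊗β) = Bα⊗β - α⊗Bβ`. -/
def tAct (B : M.V → M.V) (T : M.V → M.V → M.F) (Y Z : M.V) : M.F :=
  -T (B Y) Z + T Y (B Z)

/-- The endomorphism associated with a 2-tensor `T` via `T(Y,Z) = g((toEnd T) Y, Z)`. -/
def toEnd (T : M.V → M.V → M.F) (X : M.V) : M.V := ∑ k, T X (M.e k) • M.e k

/-- Covariant derivative of an endomorphism field. -/
def DEnd (X : M.V) (Sm : M.V → M.V) (Y : M.V) : M.V := M.nabla X (Sm Y) - Sm (M.nabla X Y)

/-- Hermitian covariant derivative of an endomorphism field. -/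
def DbEnd (X : M.V) (Sm : M.V → M.V) (Y : M.V) : M.V := M.nb X (Sm Y) - Sm (M.nb X Y)

/-- The divergence `δS = -∑ᵢ (∇_{eᵢ} S)(eᵢ)` of a (symmetric) endomorphism field. -/
def divE (Sm : M.V → M.V) : M.V := -∑ i, M.DEnd (M.e i) Sm (M.e i)

/-- Commutator of endomorphism fields (the derivation action `B⋆` on endomorphisms). -/
def commE (B Sm : M.V → M.V) (Y : M.V) : M.V := B (Sm Y) - Sm (B Y)

/-- Anticommutator of endomorphism fields (the modified action `Ã_{B⋆}` on endomorphisms). -/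
def acommE (B Sm : M.V → M.V) (Y : M.V) : M.V := B (Sm Y) + Sm (B Y)

/-- `F`-linearity of an endomorphism field. -/
def IsEndo (Sm : M.V → M.V) : Prop :=
  (∀ X Y, Sm (X + Y) = Sm X + Sm Y) ∧ ∀ (f : M.F) X, Sm (f • X) = f • Sm X

/-- Symmetric endomorphism fields. -/
def IsSymEnd (Sm : M.V → M.V) : Prop := M.IsEndo Sm ∧ ∀ X Y, M.g (Sm X) Y = M.g X (Sm Y)

/-- `Sym⁺M`: symmetric endomorphisms commuting with `J`. -/
def IsSymPlus (Sm : M.V → M.V) : Prop := M.IsSymEnd Sm ∧ ∀ X, Sm (M.J X) = M.J (Sm X)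

/-- `Sym⁺₀M`: trace-free symmetric endomorphisms commuting with `J`. -/
def IsSymPlus0 (Sm : M.V → M.V) : Prop :=
  M.IsSymPlus Sm ∧ (∑ i, M.g (Sm (M.e i)) (M.e i)) = 0

/-- `Sym⁻M`: symmetric endomorphisms anticommuting with `J`. -/
def IsSymMinus (Sm : M.V → M.V) : Prop := M.IsSymEnd Sm ∧ ∀ X, Sm (M.J X) = -M.J (Sm X)

/-- 2-forms (skew symmetric `F`-bilinear). -/
def IsForm2 (α : M.V → M.V → M.F) : Prop :=
  (∀ (f : M.F) X X' Y, α (f • X + X') Y = f * α X Y + α X' Y) ∧ ∀ X Y, α X Y = -α Y X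

/-- `(1,1)`-forms. -/
def Is11 (α : M.V → M.V → M.F) : Prop := M.IsForm2 α ∧ ∀ X Y, α (M.J X) (M.J Y) = α X Y

/-- `Λ^{(1,1)}₀M`: primitive `(1,1)`-forms (trace-free w.r.t. `ω`). -/
def IsPrim11 (α : M.V → M.V → M.F) : Prop :=
  M.Is11 α ∧ (∑ i, α (M.e i) (M.J (M.e i))) = 0

/-- 3-forms. -/
def IsForm3 (σ : M.V → M.V → M.V → M.F) : Prop :=
  (∀ (f : M.F) X X' Y Z, σ (f • X + X') Y Z = f * σ X Y Z + σ X' Y Z)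
    ∧ (∀ X Y Z, σ X Y Z = -σ Y X Z) ∧ (∀ X Y Z, σ X Y Z = -σ X Z Y)

/-- The bundle map `Π : S_{1/2}⊗TM → S_{1/2}`, `ζ⊗X ↦ X·ζ`; a section of `S_{1/2}⊗TM`
is represented by its components `φ : Fin 6 → Sp` w.r.t. the orthonormal frame `e`,
i.e. `φ` stands for `∑ᵢ φ i ⊗ e i`.  `S_{3/2} = ker Π`. -/
def PiMap (φ : Fin 6 → M.Sp) : M.Sp := ∑ i, M.c (M.e i) (φ i)

/-- Clifford multiplication by a 2-form. -/
def cForm2 (α : M.V → M.V → M.F) (s : M.Sp) : M.Sp :=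
  (1 / 2 : ℝ) • ∑ i, ∑ j, α (M.e i) (M.e j) • M.c (M.e i) (M.c (M.e j) s)

/-- Clifford multiplication by a 3-form. -/
def cForm3 (α : M.V → M.V → M.V → M.F) (s : M.Sp) : M.Sp :=
  (1 / 6 : ℝ) • ∑ i, ∑ j, ∑ k,
    α (M.e i) (M.e j) (M.e k) • M.c (M.e i) (M.c (M.e j) (M.c (M.e k) s))

/-- Clifford multiplication by the volume form. -/
def cVol (s : M.Sp) : M.Sp :=
  (1 / 720 : ℝ) • ∑ σ : Fin 6 → Fin 6, M.vol6 (fun a => M.e (σ a)) •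
    M.c (M.e (σ 0)) (M.c (M.e (σ 1)) (M.c (M.e (σ 2))
      (M.c (M.e (σ 3)) (M.c (M.e (σ 4)) (M.c (M.e (σ 5)) s)))))

/-- The canonical Hermitian connection on spinors,
`∇̄_X ζ = ∇_X ζ - (1/4)(X⌟ψ⁻)·ζ`. -/
def nbS (X : M.V) (s : M.Sp) : M.Sp := M.nablaS X s - (1 / 4 : ℝ) • M.cForm2 (M.psiM X) s

/-- The curvature of the canonical Hermitian connection on spinors. -/
def RbS (X Y : M.V) (s : M.Sp) : M.Sp :=
  M.nbS X (M.nbS Y s) - M.nbS Y (M.nbS X s) - M.nbS (M.bracket X Y) s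

/-- Clifford multiplication by the 2-form `X∧Y`, namely `X·Y· + g(X,Y)`. -/
def cWedge (X Y : M.V) (s : M.Sp) : M.Sp := M.c X (M.c Y s) + M.g X Y • s

/-- The curvature endomorphism `q(R̄) = (1/2)∑ (eᵢ∧eⱼ)⋆ R̄(eᵢ∧eⱼ)⋆` on spinors,
where `R̄(eᵢ∧eⱼ) = (1/2)∑ R̄_{ijab} e_a∧e_b`. -/
def qS (s : M.Sp) : M.Sp :=
  (1 / 2 : ℝ) • ∑ i, ∑ j, M.cWedge (M.e i) (M.e j)
    ((1 / 2 : ℝ) • ∑ a, ∑ b,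
      M.g (M.Rb (M.e i) (M.e j) (M.e a)) (M.e b) • M.cWedge (M.e a) (M.e b) s)

/-- The tensor product connection on `S_{1/2}⊗TM`, in frame components. -/
def nablaTw (X : M.V) (φ : Fin 6 → M.Sp) (k : Fin 6) : M.Sp :=
  M.nablaS X (φ k) + ∑ i, M.g (M.nabla X (M.e i)) (M.e k) • φ i

/-- The Hermitian tensor product connection on `S_{1/2}⊗TM`, in frame components. -/
def nbTw (X : M.V) (φ : Fin 6 → M.Sp) (k : Fin 6) : M.Sp :=
  M.nbS X (φ k) + ∑ i, M.g (M.nb X (M.e i)) (M.e k) • φ i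

/-- The twisted Dirac operator `D_TM = ∑ (eⱼ·⊗Id)∇_{eⱼ}` on `S_{1/2}⊗TM`. -/
def DTw (φ : Fin 6 → M.Sp) (k : Fin 6) : M.Sp := ∑ j, M.c (M.e j) (M.nablaTw (M.e j) φ k)

/-- The twisted Dirac operator `D̄_TM` of the canonical Hermitian connection. -/
def DbTw (φ : Fin 6 → M.Sp) (k : Fin 6) : M.Sp := ∑ j, M.c (M.e j) (M.nbTw (M.e j) φ k)

/-- The projection of `S_{1/2}⊗TM` onto `S_{3/2} = ker Π`. -/
def proj32 (φ : Fin 6 → M.Sp) (k : Fin 6) : M.Sp :=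
  φ k + (1 / 6 : ℝ) • M.c (M.e k) (M.PiMap φ)

/-- The Rarita-Schwinger operator `Q`, the `S_{3/2}`-component of `D_TM`. -/
def Qop (φ : Fin 6 → M.Sp) : Fin 6 → M.Sp := M.proj32 (M.DTw φ)

/-- Rarita-Schwinger fields: sections of `S_{3/2} = ker Π` with `D_TM φ = 0`. -/
def IsRS (φ : Fin 6 → M.Sp) : Prop := M.PiMap φ = 0 ∧ M.DTw φ = 0

/-- The action of the 2-form `X∧Y` on `S_{1/2}⊗TM` (Clifford on the spinor part,
skew endomorphism on the tangent part). -/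
def wAct (X Y : M.V) (φ : Fin 6 → M.Sp) (k : Fin 6) : M.Sp :=
  M.cWedge X Y (φ k) +
    ∑ i, (M.g X (M.e i) * M.g Y (M.e k) - M.g Y (M.e i) * M.g X (M.e k)) • φ i

/-- The curvature endomorphism `q(R̄)` on `S_{1/2}⊗TM`. -/
def qTw (φ : Fin 6 → M.Sp) : Fin 6 → M.Sp :=
  (1 / 2 : ℝ) • ∑ i, ∑ j, M.wAct (M.e i) (M.e j)
    ((1 / 2 : ℝ) • ∑ a, ∑ b,
      M.g (M.Rb (M.e i) (M.e j) (M.e a)) (M.e b) • M.wAct (M.e a) (M.e b) φ)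

/-- The rough Laplacian `∇*∇ = -∑ ∇_{eᵢ}∇_{eᵢ} + ∇_{∇_{eᵢ}eᵢ}` on `S_{1/2}⊗TM`. -/
def roughTw (φ : Fin 6 → M.Sp) : Fin 6 → M.Sp :=
  -∑ i, M.nablaTw (M.e i) (M.nablaTw (M.e i) φ) + ∑ i, M.nablaTw (M.nabla (M.e i) (M.e i)) φ

/-- The rough Laplacian `∇̄*∇̄` of the Hermitian connection on `S_{1/2}⊗TM`. -/
def roughBarTw (φ : Fin 6 → M.Sp) : Fin 6 → M.Sp :=
  -∑ i, M.nbTw (M.e i) (M.nbTw (M.e i) φ) + ∑ i, M.nbTw (M.nabla (M.e i) (M.e i)) φ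

/-- The Hermitian Laplace operator `Δ̄ = ∇̄*∇̄ + q(R̄)` on `S_{1/2}⊗TM`. -/
def laplBarTw (φ : Fin 6 → M.Sp) : Fin 6 → M.Sp := M.roughBarTw φ + M.qTw φ

/-- Killing spinors with Killing number `1/2`: `∇_X κ = (1/2) X·κ`. -/
def IsKilling (κ : M.Sp) : Prop := ∀ X, M.nablaS X κ = (1 / 2 : ℝ) • M.c X κ

/-- The Hodge Laplace operator on 2-forms. -/
def lapl2 (α : M.V → M.V → M.F) : M.V → M.V → M.F :=
  fun X Y => M.d1 (M.delta2 α) X Y + M.delta3 (M.d2 α) X Y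

/-- The Hodge Laplace operator on 3-forms. -/
def lapl3 (σ : M.V → M.V → M.V → M.F) : M.V → M.V → M.V → M.F :=
  fun X Y Z => M.d2 (M.delta3 σ) X Y Z + M.delta4 (M.d3 σ) X Y Z

end NK6

end

namespace Matrix

/-- The minors of size larger than the trace of an idempotent matrix over a local ring of
characteristic zero vanish. -/
theorem det_mul_idempotent_mul_eq_zero_of_isLocalRing {R n : Type*} [CommRing R] [IsLocalRing R]
    [CharZero R] [Fintype n] [DecidableEq n] {p : Matrix n n R} (hp : p * p = p) {k m : ℕ}
    (htr : p.trace = k) (hkm : k < m) (D : Matrix (Fin m) n R) (C : Matrix n (Fin m) R) :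
    (D * p * C).det = 0 := by
  set f : (n → R) →ₗ[R] (n → R) := Matrix.toLin' p with hf
  have hff : f ∘ₗ f = f := by rw [hf, ← Matrix.toLin'_mul, hp]
  have hproj : LinearMap.IsProj (LinearMap.range f) f :=
    ⟨fun x => ⟨x, rfl⟩, by rintro _ ⟨x, rfl⟩; exact LinearMap.congr_fun hff x⟩
  have hprojR : Module.Projective R (LinearMap.range f) :=
    Module.Projective.of_split (LinearMap.range f).subtype f.rangeRestrict (by
      ext x : 2
      exact hproj.map_id x x.2)
  obtain ⟨r, hr⟩ : ∃ r : (n → R) →ₗ[R] LinearMap.ker f, ∀ x : LinearMap.ker f, r x = x :=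
    ⟨(LinearMap.id - f).codRestrict (LinearMap.ker f) (fun x => by
        have := LinearMap.congr_fun hff x
        simp only [LinearMap.comp_apply] at this
        simp [this]), fun x => by ext1; simp⟩
  have hprojK : Module.Projective R (LinearMap.ker f) :=
    Module.Projective.of_split (LinearMap.ker f).subtype r (LinearMap.ext hr)
  have hfinK : Module.Finite R (LinearMap.ker f) :=
    Module.Finite.of_surjective r fun x => ⟨x, hr x⟩
  have : Module.Free R (LinearMap.range f) := Module.free_of_flat_of_isLocalRing
  have : Module.Free R (LinearMap.ker f) := Module.free_of_flat_of_isLocalRing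
  have hrank : Module.finrank R (LinearMap.range f) = k := by
    have h := hproj.trace
    rw [hf, Matrix.trace_toLin'_eq, htr] at h
    exact_mod_cast h.symm
  let b := Module.finBasisOfFinrankEq R (LinearMap.range f) hrank
  let Φ : (LinearMap.range f) [⋀^Fin m]→ₗ[R] R :=
    (Matrix.detRowAlternating (R := R) (n := Fin m)).compLinearMap
      (Matrix.toLin' D ∘ₗ (LinearMap.range f).subtype)
  have hΦ : Φ = 0 := b.ext_alternating fun v hv => by
    have := Fintype.card_le_of_injective v hv
    simp at this
    omega
  have := congrArg (fun Ψ => Ψ fun j => f.rangeRestrict (C.col j)) hΦ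
  rw [← Matrix.det_transpose]
  refine Eq.trans ?_ this
  change _ = Matrix.det _
  congr 1
  ext i j
  simp [hf, Matrix.mul_assoc, Matrix.mul_apply, Matrix.mulVec, dotProduct]

/-- The minors of size larger than the trace of an idempotent matrix vanish over every
commutative `ℚ`-algebra. -/
theorem det_mul_idempotent_mul_eq_zero {R n : Type*} [CommRing R] [Algebra ℚ R]
    [Fintype n] [DecidableEq n] {p : Matrix n n R} (hp : p * p = p) {k m : ℕ}
    (htr : p.trace = k) (hkm : k < m) (D : Matrix (Fin m) n R) (C : Matrix n (Fin m) R) :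
    (D * p * C).det = 0 := by
  refine eq_zero_of_localization _ fun I hI => ?_
  let φ := algebraMap R (Localization.AtPrime I)
  have : Algebra ℚ (Localization.AtPrime I) := (φ.comp (algebraMap ℚ R)).toAlgebra
  have : CharZero (Localization.AtPrime I) := algebraRat.charZero _
  rw [RingHom.map_det, RingHom.mapMatrix_apply, Matrix.map_mul, Matrix.map_mul]
  refine det_mul_idempotent_mul_eq_zero_of_isLocalRing (k := k) ?_ ?_ hkm _ _
  · rw [← Matrix.map_mul, hp]
  · rw [← AddMonoidHom.map_trace, htr]
    simp

/-- The derivation extension of `A` multiplies the determinant by the trace of `A`. -/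
theorem sum_det_updateRow_vecMul {R n : Type*} [CommRing R] [Fintype n] [DecidableEq n]
    (N A : Matrix n n R) : ∑ s, (N.updateRow s (N s ᵥ* A)).det = A.trace * N.det := by
  have h (s : n) : (N.updateRow s (N s ᵥ* A)).det = (N * A * N.adjugate) s s := by
    rw [Matrix.det_eq_sum_mul_adjugate_row _ s, Matrix.mul_apply]
    refine Finset.sum_congr rfl fun j _ => ?_
    rw [Matrix.updateRow_self, Matrix.adjugate_apply, Matrix.adjugate_apply,
      Matrix.updateRow_idem]
    rfl
  simp_rw [h]
  change Matrix.trace (N * A * N.adjugate) = _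
  rw [Matrix.trace_mul_cycle, Matrix.adjugate_mul]
  simp [mul_comm]

end Matrix

namespace NK6

variable (M : NK6)

section Frame

variable {M}

theorem g_isLinear_left (Y : M.V) : IsLinearMap M.F fun X => M.g X Y :=
  ⟨fun X X' => M.g_add₁ X X' Y, fun f X => M.g_smul₁ f X Y⟩

theorem g_isLinear_right (X : M.V) : IsLinearMap M.F fun Y => M.g X Y := by
  simpa only [M.g_symm X] using g_isLinear_left X

theorem J_isLinear : IsLinearMap M.F M.J := ⟨M.J_add, M.J_smul⟩

theorem g_J_left (X Y : M.V) : M.g (M.J X) Y = -M.g X (M.J Y) := by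
  have h := M.J_metric X (M.J Y)
  rw [M.J_sq, (g_isLinear_right _).map_neg] at h
  rw [← h, neg_neg]

theorem g_J_self_comm (X Y : M.V) : M.g (M.J X) Y = -M.g (M.J Y) X := by
  rw [g_J_left, M.g_symm]

theorem frame_contract {N : Type*} [AddCommGroup N] [Module M.F N] {φ : M.V → N}
    (hφ : IsLinearMap M.F φ) (X : M.V) : ∑ i, M.g X (M.e i) • φ (M.e i) = φ X := by
  conv_rhs => rw [M.frame_span X]
  rw [← hφ.mk'_apply (∑ i, M.g X (M.e i) • M.e i), map_sum]
  simp

/-- Bilinear forms can be contracted with an endomorphism or with its transpose. -/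
theorem frame_transpose {B : M.V → M.V → M.F} (hB₁ : ∀ Y, IsLinearMap M.F fun X => B X Y)
    (hB₂ : ∀ X, IsLinearMap M.F (B X)) {S T : M.V → M.V}
    (hST : ∀ X Y, M.g (S X) Y = M.g X (T Y)) :
    ∑ i, B (S (M.e i)) (M.e i) = ∑ i, B (M.e i) (T (M.e i)) := by
  have h₁ (i) := frame_contract (hB₁ (M.e i)) (S (M.e i))
  have h₂ (i) := frame_contract (hB₂ (M.e i)) (T (M.e i))
  simp_rw [← h₁, ← h₂]
  rw [Finset.sum_comm]
  simp_rw [hST, M.g_symm (T _)]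

theorem isLinear_comp_J {φ : M.V → M.F} (hφ : IsLinearMap M.F φ) :
    IsLinearMap M.F fun X => φ (M.J X) :=
  ⟨fun X Y => by rw [M.J_add, hφ.map_add], fun f X => by rw [M.J_smul, hφ.map_smul]⟩

theorem frame_J {B : M.V → M.V → M.F} (hB₁ : ∀ Y, IsLinearMap M.F fun X => B X Y)
    (hB₂ : ∀ X, IsLinearMap M.F (B X)) :
    ∑ i, B (M.J (M.e i)) (M.e i) = -∑ i, B (M.e i) (M.J (M.e i)) := by
  rw [frame_transpose hB₁ hB₂ (T := fun X => -M.J X) fun X Y => by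
    rw [g_J_left, (g_isLinear_right _).map_neg], ← Finset.sum_neg_distrib]
  simp_rw [(hB₂ _).map_neg]

theorem frame_J_J {B : M.V → M.V → M.F} (hB₁ : ∀ Y, IsLinearMap M.F fun X => B X Y)
    (hB₂ : ∀ X, IsLinearMap M.F (B X)) :
    ∑ i, B (M.J (M.e i)) (M.J (M.e i)) = ∑ i, B (M.e i) (M.e i) := by
  rw [frame_transpose (B := fun X Y => B X (M.J Y)) (S := M.J) (T := fun X => -M.J X)
    (fun Y => hB₁ _) (fun X => isLinear_comp_J (hB₂ X)) fun X Y => by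
      rw [g_J_left, (g_isLinear_right _).map_neg]]
  simp_rw [J_isLinear.map_neg, M.J_sq, neg_neg]

theorem eq_zero_of_natCast_mul_eq_zero {n : ℕ} (hn : n ≠ 0) {x : M.F} (h : (n : M.F) * x = 0) :
    x = 0 := by
  have h' : (n : ℝ) • x = 0 := by rw [Nat.cast_smul_eq_nsmul, nsmul_eq_mul, h]
  simpa [hn] using congrArg (fun y => (n : ℝ)⁻¹ • y) h'

theorem trace_J : ∑ i, M.g (M.J (M.e i)) (M.e i) = 0 := by
  have h := frame_J (B := M.g) g_isLinear_left g_isLinear_right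
  simp_rw [fun i => M.g_symm (M.e i) (M.J (M.e i))] at h
  exact eq_zero_of_natCast_mul_eq_zero two_ne_zero (by push_cast; linear_combination h)

end Frame

/-- The complexification of the ring of functions. -/
abbrev FC := QuadraticAlgebra M.F (-1) 0

/-- The Hermitian metric, sesquilinear extension of `g - i ω`. -/
def herm (X Y : M.V) : M.FC := ⟨M.g X Y, -M.g (M.J X) Y⟩

theorem FC.re_sum {ι : Type*} (s : Finset ι) (f : ι → M.FC) :
    (∑ i ∈ s, f i).re = ∑ i ∈ s, (f i).re :=
  map_sum (⟨⟨QuadraticAlgebra.re, rfl⟩, fun _ _ => rfl⟩ : M.FC →+ M.F) f s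

theorem FC.im_sum {ι : Type*} (s : Finset ι) (f : ι → M.FC) :
    (∑ i ∈ s, f i).im = ∑ i ∈ s, (f i).im :=
  map_sum (⟨⟨QuadraticAlgebra.im, rfl⟩, fun _ _ => rfl⟩ : M.FC →+ M.F) f s

theorem herm_contract_herm (X Y : M.V) :
    ∑ i, M.herm X (M.e i) * M.herm (M.e i) Y = 2 * M.herm X Y := by
  have h₁ := frame_contract (g_isLinear_left Y) X
  have h₂ := frame_contract (g_isLinear_left Y) (M.J X)
  have h₃ := frame_contract (isLinear_comp_J (g_isLinear_left Y)) X
  have h₄ := frame_contract (isLinear_comp_J (g_isLinear_left Y)) (M.J X)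
  simp only [smul_eq_mul, M.J_sq, (g_isLinear_left Y).map_neg] at h₁ h₂ h₃ h₄
  ext
  · simp only [FC.re_sum, herm, QuadraticAlgebra.re_mul, Finset.sum_add_distrib,
      neg_mul, mul_neg, neg_neg, one_mul, Finset.sum_neg_distrib, h₁, h₄, two_mul,
      QuadraticAlgebra.re_add]
  · simp only [FC.im_sum, herm, QuadraticAlgebra.im_mul, Finset.sum_add_distrib,
      mul_neg, neg_mul, Finset.sum_neg_distrib, h₂, h₃, two_mul, QuadraticAlgebra.im_add, zero_mul]
    ring

/-- The `4 × 4` minors of the Hermitian metric vanish, as the complex dimension is `3`. -/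
theorem det_herm_eq_zero (u v : Fin 4 → M.V) :
    (Matrix.of fun i j => M.herm (u i) (v j)).det = 0 := by
  let : Algebra ℚ M.FC := ((algebraMap ℝ M.FC).comp (algebraMap ℚ ℝ)).toAlgebra
  have half (x : M.FC) : (1 / 2 : ℚ) • (2 * x) = x := by
    rw [two_mul, ← two_smul ℚ, smul_smul]
    norm_num
  let p : Matrix (Fin 6) (Fin 6) M.FC := Matrix.of fun i j => (1 / 2 : ℚ) • M.herm (M.e i) (M.e j)
  have hp : p * p = p := by
    ext1 i j
    simp_rw [p, Matrix.mul_apply, Matrix.of_apply, smul_mul_smul_comm, ← Finset.smul_sum,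
      herm_contract_herm, mul_smul, half]
  have htr : p.trace = (3 : ℕ) := by
    have h : ∑ i, M.herm (M.e i) (M.e i) = 2 * (1 + 1 + 1) := by
      rw [two_mul]
      have re_one : (1 : M.FC).re = 1 := rfl
      have im_one : (1 : M.FC).im = 0 := rfl
      ext
      · simp [re_one, FC.re_sum, herm, M.orthonormal]
        norm_num
      · simp [im_one, FC.im_sum, herm, trace_J]
    simp only [p, Matrix.trace, Matrix.diag_apply, Matrix.of_apply, ← Finset.smul_sum, h, half]
    norm_num
  have h := Matrix.det_mul_idempotent_mul_eq_zero hp htr (by norm_num : 3 < 4)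
    (Matrix.of fun i j => M.herm (u i) (M.e j)) (Matrix.of fun i j => M.herm (M.e i) (v j))
  have h' : (Matrix.of fun i j => M.herm (u i) (M.e j)) * p *
      (Matrix.of fun i j => M.herm (M.e i) (v j)) =
      (2 : ℚ) • Matrix.of fun i j => M.herm (u i) (v j) := by
    ext1 i j
    simp only [p, Matrix.mul_apply, Matrix.of_apply, mul_smul_comm, ← Finset.smul_sum,
      herm_contract_herm, half, Matrix.smul_apply]
    rw [two_mul, two_smul]
  rw [h', Matrix.det_smul_of_tower] at h
  simpa using congrArg (fun x => ((1 / 16 : ℚ) • x : M.FC)) h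

end NK6

namespace NK6

variable (M : NK6)

/-- Real parts of complex `(3,0)`-forms. -/
def IsType30 (α : M.V → M.V → M.V → M.F) : Prop :=
  M.IsForm3 α ∧ ∀ X Y Z, α (M.J X) Y Z = α X (M.J Y) Z

/-- The complex `(3,0)`-form with real part `α`. -/
def cplx (α : M.V → M.V → M.V → M.F) (X Y Z : M.V) : M.FC := ⟨α X Y Z, α (M.J X) Y Z⟩

variable {M} {α β : M.V → M.V → M.V → M.F}

section Form3

theorem IsForm3.swap₁₂ (hα : M.IsForm3 α) (X Y Z : M.V) : α X Y Z = -α Y X Z := hα.2.1 X Y Z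

theorem IsForm3.swap₂₃ (hα : M.IsForm3 α) (X Y Z : M.V) : α X Y Z = -α X Z Y := hα.2.2 X Y Z

theorem IsForm3.cycle (hα : M.IsForm3 α) (X Y Z : M.V) : α X Y Z = α Y Z X := by
  rw [hα.swap₁₂, hα.swap₂₃, neg_neg]

theorem IsForm3.isLinear₁ (hα : M.IsForm3 α) (Y Z : M.V) : IsLinearMap M.F fun X => α X Y Z := by
  have h0 : α 0 Y Z = 0 := by simpa using hα.1 1 0 0 Y Z
  exact ⟨fun X X' => by simpa using hα.1 1 X X' Y Z, fun f X => by simpa [h0] using hα.1 f X 0 Y Z⟩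

theorem IsForm3.isLinear₂ (hα : M.IsForm3 α) (X Z : M.V) : IsLinearMap M.F fun Y => α X Y Z := by
  simp_rw [fun Y => hα.swap₁₂ X Y Z]
  exact (-(hα.isLinear₁ X Z).mk').isLinear

theorem IsForm3.isLinear₃ (hα : M.IsForm3 α) (X Y : M.V) : IsLinearMap M.F fun Z => α X Y Z := by
  simpa only [fun Z => (hα.cycle Z X Y)] using hα.isLinear₁ X Y

theorem IsForm3.self₁₂ (hα : M.IsForm3 α) (X Z : M.V) : α X X Z = 0 :=
  eq_zero_of_natCast_mul_eq_zero two_ne_zero (by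
    push_cast; linear_combination hα.swap₁₂ X X Z)

end Form3

namespace IsType30

theorem J₂ (hα : M.IsType30 α) (X Y Z : M.V) : α X (M.J Y) Z = α (M.J X) Y Z := (hα.2 X Y Z).symm

theorem J₃ (hα : M.IsType30 α) (X Y Z : M.V) : α X Y (M.J Z) = α (M.J X) Y Z := by
  rw [← hα.1.cycle (M.J Z), hα.2, hα.1.cycle]

/-- Contraction with the Hermitian metric doubles a `(3,0)`-form. -/
theorem cplx_contract (hα : M.IsType30 α) (X Y Z : M.V) :
    ∑ i, M.cplx α (M.e i) Y Z * M.herm (M.e i) X = 2 * M.cplx α X Y Z := by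
  have h₁ := frame_contract (hα.1.isLinear₁ Y Z) X
  have h₂ := frame_contract (isLinear_comp_J (hα.1.isLinear₁ Y Z)) X
  have h₃ := frame_contract (hα.1.isLinear₁ Y Z) (M.J X)
  have h₄ := frame_contract (isLinear_comp_J (hα.1.isLinear₁ Y Z)) (M.J X)
  simp only [smul_eq_mul, M.J_sq, (hα.1.isLinear₁ Y Z).map_neg, neg_inj, g_J_self_comm X,
    M.g_symm X, neg_mul, Finset.sum_neg_distrib] at h₁ h₂ h₃ h₄
  ext
  · simp only [FC.re_sum, herm, cplx, QuadraticAlgebra.re_mul, Finset.sum_add_distrib, two_mul,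
      QuadraticAlgebra.re_add, neg_mul, mul_neg, neg_neg, one_mul, mul_comm (α _ _ _), h₁, h₄]
  · simp only [FC.im_sum, herm, cplx, QuadraticAlgebra.im_mul, Finset.sum_add_distrib, two_mul,
      QuadraticAlgebra.im_add, neg_mul, mul_neg, zero_mul, Finset.sum_neg_distrib,
      mul_comm (α _ _ _), h₂, h₃]
    ring

theorem cplx_swap₁₂ (hα : M.IsType30 α) (X Y Z : M.V) : M.cplx α X Y Z = -M.cplx α Y X Z := by
  ext
  · simpa [cplx] using hα.1.swap₁₂ X Y Z
  · simpa [cplx, hα.2] using hα.1.swap₁₂ (M.J X) Y Z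

theorem cplx_swap₂₃ (hα : M.IsType30 α) (X Y Z : M.V) : M.cplx α X Y Z = -M.cplx α X Z Y := by
  ext
  · simpa [cplx] using hα.1.swap₂₃ X Y Z
  · simpa [cplx] using hα.1.swap₂₃ (M.J X) Y Z

theorem cplx_contract₂ (hα : M.IsType30 α) (X Y Z : M.V) :
    ∑ i, M.cplx α X (M.e i) Z * M.herm (M.e i) Y = 2 * M.cplx α X Y Z := by
  simp_rw [fun Y => hα.cplx_swap₁₂ X Y Z, neg_mul, Finset.sum_neg_distrib, hα.cplx_contract,
    mul_neg]

theorem cplx_contract₃ (hα : M.IsType30 α) (X Y Z : M.V) :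
    ∑ i, M.cplx α X Y (M.e i) * M.herm (M.e i) Z = 2 * M.cplx α X Y Z := by
  simp_rw [fun Z => hα.cplx_swap₂₃ X Y Z, neg_mul, Finset.sum_neg_distrib,
    hα.cplx_contract₂, mul_neg]

theorem cplx_contract_prod (hα : M.IsType30 α) (X Y Z : M.V) :
    ∑ a, ∑ b, ∑ c, M.cplx α (M.e a) (M.e b) (M.e c) *
      (M.herm (M.e a) X * M.herm (M.e b) Y * M.herm (M.e c) Z) = 8 * M.cplx α X Y Z := by
  have h (a b c) : M.cplx α (M.e a) (M.e b) (M.e c) *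
      (M.herm (M.e a) X * M.herm (M.e b) Y * M.herm (M.e c) Z) =
      (M.cplx α (M.e a) (M.e b) (M.e c) * M.herm (M.e c) Z) *
        (M.herm (M.e a) X * M.herm (M.e b) Y) := by ring
  have h' (a b) : 2 * M.cplx α (M.e a) (M.e b) Z * (M.herm (M.e a) X * M.herm (M.e b) Y) =
      (M.cplx α (M.e a) (M.e b) Z * M.herm (M.e b) Y) * (2 * M.herm (M.e a) X) := by ring
  have h'' (a) : 2 * M.cplx α (M.e a) Y Z * (2 * M.herm (M.e a) X) =
      4 * (M.cplx α (M.e a) Y Z * M.herm (M.e a) X) := by ring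
  simp_rw [h, ← Finset.sum_mul, hα.cplx_contract₃, h', ← Finset.sum_mul, hα.cplx_contract₂, h'',
    ← Finset.mul_sum, hα.cplx_contract]
  ring

theorem cplx_contract_det (hα : M.IsType30 α) (v : Fin 3 → M.V) :
    ∑ a, ∑ b, ∑ c, M.cplx α (M.e a) (M.e b) (M.e c) *
      (Matrix.of fun i j => M.herm (![M.e a, M.e b, M.e c] i) (v j)).det =
    48 * M.cplx α (v 0) (v 1) (v 2) := by
  simp only [Matrix.det_fin_three, Matrix.of_apply, Matrix.cons_val, mul_add, mul_sub,
    Finset.sum_add_distrib, Finset.sum_sub_distrib, hα.cplx_contract_prod]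
  linear_combination -16 * hα.cplx_swap₂₃ (v 0) (v 2) (v 1)
    - 24 * hα.cplx_swap₁₂ (v 1) (v 0) (v 2) + 16 * hα.cplx_swap₂₃ (v 1) (v 2) (v 0)
    + 8 * hα.cplx_swap₁₂ (v 2) (v 0) (v 1) - 8 * hα.cplx_swap₁₂ (v 2) (v 1) (v 0)

/-- The wedge product of a `(1,0)`-form and a `(3,0)`-form vanishes. -/
theorem cplx_wedge (hα : M.IsType30 α) (u : M.V) (X Y Z W : M.V) :
    M.herm u X * M.cplx α Y Z W - M.herm u Y * M.cplx α X Z W + M.herm u Z * M.cplx α X Y W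
      - M.herm u W * M.cplx α X Y Z = 0 := by
  let v : Fin 4 → M.V := ![X, Y, Z, W]
  have hdet (a b c : M.V) : ∑ j : Fin 4, (-1) ^ (j : ℕ) * M.herm u (v j) *
      (Matrix.of fun i k => M.herm (![a, b, c] i) (v (j.succAbove k))).det = 0 := by
    rw [← M.det_herm_eq_zero ![u, a, b, c] v, Matrix.det_succ_row_zero]
    rfl
  have h : ∑ j : Fin 4, (-1) ^ (j : ℕ) * M.herm u (v j) * ∑ a, ∑ b, ∑ c,
      M.cplx α (M.e a) (M.e b) (M.e c) * (Matrix.of fun i k =>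
        M.herm (![M.e a, M.e b, M.e c] i) (v (j.succAbove k))).det = 0 := by
    simp_rw [Finset.mul_sum]
    rw [Finset.sum_comm]
    refine Finset.sum_eq_zero fun a _ => ?_
    rw [Finset.sum_comm]
    refine Finset.sum_eq_zero fun b _ => ?_
    rw [Finset.sum_comm]
    refine Finset.sum_eq_zero fun c _ => ?_
    simp_rw [mul_left_comm _ (M.cplx α (M.e a) (M.e b) (M.e c)), ← Finset.mul_sum, hdet, mul_zero]
  simp_rw [hα.cplx_contract_det, Fin.sum_univ_four] at h
  have h48 : (48 : ℝ) • (M.herm u X * M.cplx α Y Z W - M.herm u Y * M.cplx α X Z W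
      + M.herm u Z * M.cplx α X Y W - M.herm u W * M.cplx α X Y Z) = 0 := by
    rw [← h, Algebra.smul_def, map_ofNat]
    simp [v, Fin.succAbove]
    ring
  simpa using congrArg (fun x => (1 / 48 : ℝ) • x) h48

end IsType30

end NK6

namespace NK6

variable {M : NK6} {α β : M.V → M.V → M.V → M.F}

theorem isLinear_const_mul {φ : M.V → M.F} (hφ : IsLinearMap M.F φ) (c : M.F) :
    IsLinearMap M.F fun X => c * φ X :=
  ⟨fun X Y => by rw [hφ.map_add, mul_add],
    fun f X => by rw [hφ.map_smul, smul_eq_mul, smul_eq_mul, mul_left_comm]⟩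

theorem isLinear_mul_const {φ : M.V → M.F} (hφ : IsLinearMap M.F φ) (c : M.F) :
    IsLinearMap M.F fun X => φ X * c := by
  simpa only [mul_comm] using isLinear_const_mul hφ c

namespace IsType30

theorem wedge (hα : M.IsType30 α) (u X Y Z W : M.V) :
    (M.g u X * α Y Z W + M.g (M.J u) X * α (M.J Y) Z W)
      - (M.g u Y * α X Z W + M.g (M.J u) Y * α (M.J X) Z W)
      + (M.g u Z * α X Y W + M.g (M.J u) Z * α (M.J X) Y W)
      - (M.g u W * α X Y Z + M.g (M.J u) W * α (M.J X) Y Z) = 0 := by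
  have h := congrArg QuadraticAlgebra.re (hα.cplx_wedge u X Y Z W)
  simp only [herm, cplx, QuadraticAlgebra.re_mul, QuadraticAlgebra.re_sub,
    QuadraticAlgebra.re_add, QuadraticAlgebra.re_zero] at h
  linear_combination h

/-- A complex linear endomorphism acts on `(3,0)`-forms through its complex trace. -/
theorem derivation_eq_zero (hα : M.IsType30 α) {S : M.V → M.V} (hS : M.IsEndo S)
    (hSJ : ∀ X, S (M.J X) = M.J (S X)) (htr : ∑ i, M.g (M.e i) (S (M.e i)) = 0)
    (htrJ : ∑ i, M.g (M.J (M.e i)) (S (M.e i)) = 0) (X Y Z : M.V) :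
    α (S X) Y Z - α (S Y) X Z + α (S Z) X Y = 0 := by
  have key (X Y Z : M.V) : ∑ i, (M.g (M.e i) X * α (S (M.e i)) Y Z +
      M.g (M.J (M.e i)) X * α (M.J (S (M.e i))) Y Z) = 2 * α (S X) Y Z := by
    have hl : IsLinearMap M.F fun W => α (S W) Y Z :=
      ⟨fun V W => by rw [hS.1, (hα.1.isLinear₁ Y Z).map_add],
        fun f W => by rw [hS.2, (hα.1.isLinear₁ Y Z).map_smul]⟩
    have h₁ := frame_contract hl X
    have h₂ := frame_contract (isLinear_comp_J hl) (M.J X)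
    simp only [smul_eq_mul, M.J_sq, hl.map_neg, hSJ] at h₁ h₂
    simp_rw [g_J_self_comm _ X, M.g_symm _ X, Finset.sum_add_distrib, neg_mul,
      Finset.sum_neg_distrib, h₁, h₂]
    ring
  have h := Finset.sum_eq_zero fun (i : Fin 6) (_ : i ∈ Finset.univ) =>
    hα.wedge (M.e i) (S (M.e i)) X Y Z
  rw [Finset.sum_sub_distrib, Finset.sum_add_distrib, Finset.sum_sub_distrib, key, key, key,
    Finset.sum_add_distrib, ← Finset.sum_mul, ← Finset.sum_mul, htr, htrJ] at h
  exact eq_zero_of_natCast_mul_eq_zero two_ne_zero (by push_cast; linear_combination -h)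

/-- Contracting two `(3,0)`-forms in two slots. -/
def contr₂ (α β : M.V → M.V → M.V → M.F) (X Y : M.V) : M.F :=
  ∑ i, ∑ j, α X (M.e i) (M.e j) * β Y (M.e i) (M.e j)

theorem contr₂_J_J (hα : M.IsType30 α) (hβ : M.IsType30 β) (X Y : M.V) :
    contr₂ α β (M.J X) (M.J Y) = contr₂ α β X Y := by
  unfold contr₂
  simp_rw [← hα.J₂, ← hβ.J₂]
  rw [Finset.sum_comm, Finset.sum_comm (f := fun i j => α X (M.e i) (M.e j) * _)]
  exact Finset.sum_congr rfl fun j _ =>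
    frame_J_J (B := fun V W => α X V (M.e j) * β Y W (M.e j))
      (fun W => isLinear_mul_const (hα.1.isLinear₂ _ _) _)
      fun V => isLinear_const_mul (hβ.1.isLinear₂ _ _) _

theorem contr₂_eq (hα : M.IsType30 α) (hβ : M.IsType30 β) (X Y : M.V) :
    6 * contr₂ α β X Y =
      M.g Y X * (∑ a, ∑ b, ∑ c, α (M.e a) (M.e b) (M.e c) * β (M.e a) (M.e b) (M.e c)) +
      M.g (M.J Y) X *
        ∑ a, ∑ b, ∑ c, α (M.J (M.e a)) (M.e b) (M.e c) * β (M.e a) (M.e b) (M.e c) := by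
  have hcontr (p q : Fin 6) : ∑ r, (M.g Y (M.e r) * α X (M.e p) (M.e q) +
      M.g (M.J Y) (M.e r) * α (M.J X) (M.e p) (M.e q)) * β (M.e r) (M.e p) (M.e q) =
      α X (M.e p) (M.e q) * β Y (M.e p) (M.e q) +
        α (M.J X) (M.e p) (M.e q) * β (M.J Y) (M.e p) (M.e q) := by
    have h (Y) := frame_contract (hβ.1.isLinear₁ (M.e p) (M.e q)) Y
    simp only [smul_eq_mul] at h
    rw [← h Y, ← h (M.J Y), Finset.mul_sum, Finset.mul_sum, ← Finset.sum_add_distrib]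
    exact Finset.sum_congr rfl fun r _ => by ring
  have key : ∑ p, ∑ q, ∑ r, (M.g Y (M.e r) * α X (M.e p) (M.e q) +
      M.g (M.J Y) (M.e r) * α (M.J X) (M.e p) (M.e q)) * β (M.e r) (M.e p) (M.e q) =
      2 * contr₂ α β X Y := by
    have hJ := hα.contr₂_J_J hβ X Y
    unfold contr₂ at hJ ⊢
    simp_rw [hcontr, Finset.sum_add_distrib, hJ]
    ring
  have key₁ := key
  rw [Finset.sum_congr rfl fun p _ => Finset.sum_comm, Finset.sum_comm] at key₁
  have key₂ := key
  rw [Finset.sum_congr rfl fun p _ => Finset.sum_comm] at key₂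
  have key₀ : M.g Y X * (∑ a, ∑ b, ∑ c, α (M.e a) (M.e b) (M.e c) * β (M.e a) (M.e b) (M.e c)) +
      M.g (M.J Y) X *
        (∑ a, ∑ b, ∑ c, α (M.J (M.e a)) (M.e b) (M.e c) * β (M.e a) (M.e b) (M.e c)) =
      ∑ a, ∑ b, ∑ c, (M.g Y X * α (M.e a) (M.e b) (M.e c) +
        M.g (M.J Y) X * α (M.J (M.e a)) (M.e b) (M.e c)) * β (M.e a) (M.e b) (M.e c) := by
    simp only [Finset.mul_sum, ← Finset.sum_add_distrib]
    simp only [add_mul, mul_assoc]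
  have hsum : (6 : M.F) * contr₂ α β X Y =
      2 * contr₂ α β X Y + 2 * contr₂ α β X Y + 2 * contr₂ α β X Y := by ring
  rw [key₀, hsum]
  nth_rewrite 1 [← key₁]
  nth_rewrite 1 [← key₂]
  rw [← key]
  simp only [← Finset.sum_add_distrib]
  refine Finset.sum_congr rfl fun a _ => Finset.sum_congr rfl fun b _ =>
    Finset.sum_congr rfl fun c _ => ?_
  have hw := hα.wedge Y X (M.e a) (M.e b) (M.e c)
  have h₁ := hβ.1.swap₁₂ (M.e b) (M.e a) (M.e c)
  have h₂ := hβ.1.cycle (M.e c) (M.e a) (M.e b)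
  rw [h₁, h₂]
  linear_combination -β (M.e a) (M.e b) (M.e c) * hw

theorem plucker (hα : M.IsType30 α) (hβ : M.IsType30 β) (X Y Z W P Q : M.V) :
    (α Y Z W * β X P Q - α (M.J Y) Z W * β (M.J X) P Q)
      - (α X Z W * β Y P Q - α (M.J X) Z W * β (M.J Y) P Q)
      + (α X Y W * β Z P Q - α (M.J X) Y W * β (M.J Z) P Q)
      - (α X Y Z * β W P Q - α (M.J X) Y Z * β (M.J W) P Q) = 0 := by
  have h₁ (X) := frame_contract (hβ.1.isLinear₁ P Q) X
  simp only [smul_eq_mul] at h₁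
  have key (X : M.V) (r s : M.F) : ∑ i, (M.g (M.e i) X * r + M.g (M.J (M.e i)) X * s) *
      β (M.e i) P Q = r * β X P Q - s * β (M.J X) P Q := by
    rw [← h₁ X, ← h₁ (M.J X), Finset.mul_sum, Finset.mul_sum, ← Finset.sum_sub_distrib]
    refine Finset.sum_congr rfl fun i _ => ?_
    rw [g_J_self_comm _ X, M.g_symm _ X]
    ring
  simp only [← key, ← Finset.sum_sub_distrib, ← Finset.sum_add_distrib]
  exact Finset.sum_eq_zero fun i _ => by
    linear_combination β (M.e i) P Q * hα.wedge (M.e i) X Y Z W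

/-- The mixed contraction of two `(3,0)`-forms with an element of `Sym⁻` is symmetric. -/
theorem contr_symMinus_comm (hα : M.IsType30 α) (hβ : M.IsType30 β) {S : M.V → M.V}
    (hS : M.IsSymMinus S) (X Y : M.V) :
    ∑ i, ∑ j, α X (M.e i) (M.e j) * β Y (S (M.e i)) (M.e j) =
      ∑ i, ∑ j, α Y (M.e i) (M.e j) * β X (S (M.e i)) (M.e j) := by
  obtain ⟨⟨⟨hadd, hsmul⟩, hsym⟩, hJ⟩ := hS
  have hlin (V W : M.V) : IsLinearMap M.F fun U => β V (S U) W :=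
    ⟨fun U U' => by rw [hadd, (hβ.1.isLinear₂ V W).map_add],
      fun f U => by rw [hsmul, (hβ.1.isLinear₂ V W).map_smul]⟩
  have hK (X Y : M.V) : ∑ i, ∑ j, α (M.J X) (M.e i) (M.e j) * β (M.J Y) (S (M.e i)) (M.e j) =
      -∑ i, ∑ j, α X (M.e i) (M.e j) * β Y (S (M.e i)) (M.e j) := by
    rw [Finset.sum_comm, Finset.sum_comm (f := fun i j => α X (M.e i) (M.e j) * _),
      ← Finset.sum_neg_distrib]
    refine Finset.sum_congr rfl fun j _ => ?_
    rw [← frame_J_J (B := fun V W => α X V (M.e j) * β Y (S W) (M.e j))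
      (fun W => isLinear_mul_const (hα.1.isLinear₂ _ _) _)
      fun V => isLinear_const_mul (hlin _ _) _, ← Finset.sum_neg_distrib]
    refine Finset.sum_congr rfl fun i _ => ?_
    rw [hα.J₂, hJ, (hβ.1.isLinear₂ _ _).map_neg, hβ.J₂]
    ring
  have htrace {T : M.V → M.V} (hT : ∀ V W, M.g (T V) W = M.g V (T W)) (W : M.V) :
      ∑ i, β (M.e i) (T (M.e i)) W = 0 := by
    have h := frame_transpose (B := fun U V => β U V W) (fun V => hβ.1.isLinear₁ V W)
      (fun U => hβ.1.isLinear₂ U W) hT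
    simp_rw [hβ.1.swap₁₂ (T _), Finset.sum_neg_distrib] at h
    exact eq_zero_of_natCast_mul_eq_zero two_ne_zero (by push_cast; linear_combination -h)
  have hJS (V W : M.V) : M.g (M.J (S V)) W = M.g V (M.J (S W)) := by
    rw [g_J_left, hsym, hJ, (g_isLinear_right V).map_neg, neg_neg]
  have h₁ (j : Fin 6) : ∑ i, (α Y X (M.e j) * β (M.e i) (S (M.e i)) (M.e j) -
      α (M.J Y) X (M.e j) * β (M.J (M.e i)) (S (M.e i)) (M.e j)) = 0 := by
    simp_rw [hβ.2 (M.e _), Finset.sum_sub_distrib, ← Finset.mul_sum, htrace hsym, htrace hJS]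
    ring
  have h₂ (i j : Fin 6) : α Y X (M.e i) * β (M.e j) (S (M.e i)) (M.e j) -
      α (M.J Y) X (M.e i) * β (M.J (M.e j)) (S (M.e i)) (M.e j) = 0 := by
    have h0 (V W : M.V) : β V W V = 0 := by rw [hβ.1.swap₂₃, hβ.1.self₁₂, neg_zero]
    rw [hβ.2, h0, h0]
    ring
  have h := Finset.sum_eq_zero fun (i : Fin 6) (_ : i ∈ Finset.univ) =>
    Finset.sum_eq_zero fun (j : Fin 6) (_ : j ∈ Finset.univ) =>
      hα.plucker hβ Y X (M.e i) (M.e j) (S (M.e i)) (M.e j)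
  simp_rw [h₂, sub_zero, Finset.sum_add_distrib] at h
  rw [Finset.sum_comm (f := fun i j => α Y X (M.e j) * _ - _)] at h
  simp_rw [h₁, Finset.sum_const_zero, Finset.sum_sub_distrib, hK] at h
  exact sub_eq_zero.1 (eq_zero_of_natCast_mul_eq_zero two_ne_zero
    (by push_cast; linear_combination h))

end IsType30

end NK6

namespace NK6

variable {M : NK6} {α : M.V → M.V → M.V → M.F}

theorem g_ext {X Y : M.V} (h : ∀ Z, M.g X Z = M.g Y Z) : X = Y :=
  sub_eq_zero.1 <| M.g_nondeg _ fun Z => by rw [(g_isLinear_left Z).map_sub, h, sub_self]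

theorem IsForm3.isType30_of_J₂₃ (hα : M.IsForm3 α)
    (h : ∀ X Y Z, α X (M.J Y) Z = α X Y (M.J Z)) : M.IsType30 α :=
  ⟨hα, fun X Y Z => by rw [hα.cycle, ← h, ← hα.cycle, ← h]⟩

theorem IsForm3.const_mul (hα : M.IsForm3 α) (c : M.F) :
    M.IsForm3 fun X Y Z => c * α X Y Z :=
  ⟨fun f X X' Y Z => by linear_combination c * hα.1 f X X' Y Z,
    fun X Y Z => by linear_combination c * hα.swap₁₂ X Y Z,
    fun X Y Z => by linear_combination c * hα.swap₂₃ X Y Z⟩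

theorem IsForm3.sum {ι : Type*} {s : Finset ι} {σ : ι → M.V → M.V → M.V → M.F}
    (hσ : ∀ i, M.IsForm3 (σ i)) : M.IsForm3 fun X Y Z => ∑ i ∈ s, σ i X Y Z :=
  ⟨fun f X X' Y Z => by simp only [(hσ _).1, Finset.sum_add_distrib, Finset.mul_sum],
    fun X Y Z => by simp only [(hσ _).swap₁₂ X, Finset.sum_neg_distrib],
    fun X Y Z => by simp only [(hσ _).swap₂₃ X Y, Finset.sum_neg_distrib]⟩

theorem IsType30.comp_J (hα : M.IsType30 α) : M.IsType30 fun X Y Z => α (M.J X) Y Z :=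
  ⟨⟨fun f X X' Y Z => by simp only [M.J_add, M.J_smul, hα.1.1],
    fun X Y Z => (hα.2 X Y Z).trans (hα.1.swap₁₂ _ _ _), fun X Y Z => hα.1.swap₂₃ _ _ _⟩,
    fun X Y Z => hα.2 _ _ _⟩

theorem IsType30.neg (hα : M.IsType30 α) : M.IsType30 fun X Y Z => -α X Y Z :=
  ⟨by simpa using hα.1.const_mul (-1), fun X Y Z => congrArg _ (hα.2 X Y Z)⟩

theorem nabla_neg (X Y : M.V) : M.nabla X (-Y) = -M.nabla X Y :=
  map_neg (AddMonoidHom.mk' (M.nabla X) (M.nabla_add₂ X)) Y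

theorem psiP_isForm3 : M.IsForm3 M.psiP := by
  refine ⟨fun f X X' Y Z => ?_, fun X Y Z => ?_, fun X Y Z => ?_⟩
  · have hl := g_isLinear_left Z
    simp only [psiP, M.nabla_add₁, M.nabla_smul₁, M.J_add, M.J_smul, hl.map_sub, hl.map_add,
      hl.map_smul, smul_eq_mul]
    ring
  · have h := M.nearlyKahler (X + Y)
    simp only [M.nabla_add₁, M.nabla_add₂, M.J_add, M.nearlyKahler] at h
    have hl := g_isLinear_left Z
    have h' := congrArg (fun W => M.g W Z) h
    simp only [hl.map_add] at h'
    simp only [psiP, hl.map_sub]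
    linear_combination h'
  · have h₁ := M.nabla_metric X (M.J Y) Z
    have h₂ := M.nabla_metric X (M.J Z) Y
    rw [g_J_self_comm, map_neg] at h₂
    have h₃ := g_J_left (M.nabla X Y) Z
    have h₄ := g_J_left (M.nabla X Z) Y
    rw [M.g_symm] at h₃ h₄
    simp only [psiP, (g_isLinear_left _).map_sub]
    rw [M.g_symm (M.J (M.nabla X Y)), M.g_symm (M.J (M.nabla X Z)), h₃, h₄,
      M.g_symm _ (M.J Z), M.g_symm _ (M.J Y)]
    linear_combination -h₁ - h₂

/-- The nearly Kähler condition makes `ψ⁺` the real part of a `(3,0)`-form. -/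
theorem psiP_isType30 : M.IsType30 M.psiP :=
  psiP_isForm3.isType30_of_J₂₃ fun X Y Z => by
    have h (W : M.V) : M.g W (M.J Z) = -M.g (M.J W) Z := by rw [g_J_left, neg_neg]
    have hl := g_isLinear_left Z
    simp only [psiP, h, M.J_sq, nabla_neg, J_isLinear.map_sub, hl.map_sub, hl.map_neg]
    ring

theorem g_A (X Y Z : M.V) : M.g (M.A X Y) Z = -M.psiP (M.J X) Y Z := by
  rw [← psiP_isType30.J₃, psiP, ← g_J_left, J_isLinear.map_sub, M.J_sq, sub_neg_eq_add, A]

theorem A_isType30 : M.IsType30 fun X Y Z => M.g (M.A X Y) Z := by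
  simpa only [g_A] using psiP_isType30.comp_J.neg

theorem A_swap (X Y : M.V) : M.A X Y = -M.A Y X :=
  g_ext fun Z => by rw [(g_isLinear_left Z).map_neg, A_isType30.1.swap₁₂]

theorem A_self (X : M.V) : M.A X X = 0 :=
  M.g_nondeg _ fun Z => A_isType30.1.self₁₂ X Z

theorem A_isLinear_left (Y : M.V) : IsLinearMap M.F fun X => M.A X Y :=
  ⟨fun X X' => g_ext fun Z => by
    rw [(g_isLinear_left Z).map_add, (A_isType30.1.isLinear₁ Y Z).map_add],
    fun f X => g_ext fun Z => by
    rw [(g_isLinear_left Z).map_smul, (A_isType30.1.isLinear₁ Y Z).map_smul]⟩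

theorem A_isLinear_right (X : M.V) : IsLinearMap M.F (M.A X) := by
  rw [show M.A X = fun Y => -M.A Y X from funext fun Y => A_swap X Y]
  exact (-(A_isLinear_left X).mk').isLinear

theorem A_J_right (X Y : M.V) : M.A X (M.J Y) = -M.J (M.A X Y) :=
  g_ext fun Z => by
    rw [(g_isLinear_left Z).map_neg, g_J_left, neg_neg, A_isType30.J₂, A_isType30.J₃]

section Hodge

theorem vol6_update (Xs : Fin 6 → M.V) (s : Fin 6) (X : M.V) :
    M.vol6 (Function.update Xs s X) =
      ((Matrix.of fun i j => M.g (Xs i) (M.e j)).updateRow s fun j => M.g X (M.e j)).det := by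
  unfold vol6
  congr 1
  ext i j
  obtain rfl | h := eq_or_ne i s <;> simp [*]

theorem vol6_isLinear (Xs : Fin 6 → M.V) (s : Fin 6) :
    IsLinearMap M.F fun X => M.vol6 (Function.update Xs s X) := by
  simp only [vol6_update]
  constructor
  · intro X X'
    rw [← Matrix.det_updateRow_add]
    congr 2
    ext j
    exact M.g_add₁ _ _ _
  · intro f X
    rw [smul_eq_mul, ← Matrix.det_updateRow_smul]
    congr 2
    ext j
    exact M.g_smul₁ _ _ _

theorem vol6_swap {i j : Fin 6} (h : i ≠ j) (Xs : Fin 6 → M.V) :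
    M.vol6 Xs = -M.vol6 (Xs ∘ Equiv.swap i j) := by
  have h' := Matrix.det_permute (Equiv.swap i j) (Matrix.of fun i j => M.g (Xs i) (M.e j))
  rw [Equiv.Perm.sign_swap h] at h'
  rw [vol6, eq_neg_iff_add_eq_zero, add_comm, ← eq_neg_iff_add_eq_zero]
  exact h'.trans (by simp)

/-- `J` is trace free, so its derivation extension annihilates the volume form. -/
theorem sum_vol6_update_J (Xs : Fin 6 → M.V) :
    ∑ s, M.vol6 (Function.update Xs s (M.J (Xs s))) = 0 := by
  have h := Matrix.sum_det_updateRow_vecMul (Matrix.of fun i j => M.g (Xs i) (M.e j))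
    (Matrix.of fun i j => M.g (M.J (M.e i)) (M.e j))
  rw [Matrix.trace, Finset.sum_congr rfl fun i _ => Matrix.diag_apply _ i] at h
  simp only [Matrix.of_apply, trace_J, zero_mul] at h
  rw [← h]
  refine Finset.sum_congr rfl fun s _ => ?_
  rw [vol6_update]
  congr 2
  ext j
  exact (frame_contract (isLinear_comp_J (g_isLinear_left (M.e j))) (Xs s)).symm

theorem vol6_isForm3 (U V W : M.V) : M.IsForm3 fun X Y Z => M.vol6 ![U, V, W, X, Y, Z] := by
  refine ⟨fun f X X' Y Z => ?_, fun X Y Z => ?_, fun X Y Z => ?_⟩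
  · have hu (T : M.V) : ![U, V, W, T, Y, Z] = Function.update ![U, V, W, 0, Y, Z] 3 T := by
      ext i; fin_cases i <;> rfl
    have hl := vol6_isLinear ![U, V, W, 0, Y, Z] 3
    simp only [← hu] at hl
    exact (hl.map_add _ _).trans (congrArg (· + _) (hl.map_smul f X))
  · refine (vol6_swap (i := 3) (j := 4) (by decide) _).trans ?_
    congr 2
    ext i; fin_cases i <;> rfl
  · refine (vol6_swap (i := 4) (j := 5) (by decide) _).trans ?_
    congr 2
    ext i; fin_cases i <;> rfl

end Hodge

end NK6

namespace NK6

variable {M : NK6} {α : M.V → M.V → M.V → M.F}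

theorem star3_isForm3 (α : M.V → M.V → M.V → M.F) : M.IsForm3 (M.star3 α) := by
  have h : M.IsForm3 fun X Y Z => algebraMap ℝ M.F (1 / 6) * ∑ i, ∑ j, ∑ k,
      α (M.e i) (M.e j) (M.e k) * M.vol6 ![M.e i, M.e j, M.e k, X, Y, Z] :=
    (IsForm3.sum fun i => IsForm3.sum fun j => IsForm3.sum fun k =>
      (vol6_isForm3 (M.e i) (M.e j) (M.e k)).const_mul _).const_mul _
  simp only [← Algebra.smul_def] at h
  exact h

theorem vol6_derivation_J (U V W X Y Z : M.V) :
    M.vol6 ![U, V, W, M.J X, Y, Z] + M.vol6 ![U, V, W, X, M.J Y, Z]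
      + M.vol6 ![U, V, W, X, Y, M.J Z] =
    -(M.vol6 ![M.J U, V, W, X, Y, Z] + M.vol6 ![U, M.J V, W, X, Y, Z]
      + M.vol6 ![U, V, M.J W, X, Y, Z]) := by
  have h := sum_vol6_update_J ![U, V, W, X, Y, Z]
  rw [Fin.sum_univ_six] at h
  have h0 : Function.update ![U, V, W, X, Y, Z] 0 (M.J U) = ![M.J U, V, W, X, Y, Z] := by
    ext i; fin_cases i <;> rfl
  have h1 : Function.update ![U, V, W, X, Y, Z] 1 (M.J V) = ![U, M.J V, W, X, Y, Z] := by
    ext i; fin_cases i <;> rfl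
  have h2 : Function.update ![U, V, W, X, Y, Z] 2 (M.J W) = ![U, V, M.J W, X, Y, Z] := by
    ext i; fin_cases i <;> rfl
  have h3 : Function.update ![U, V, W, X, Y, Z] 3 (M.J X) = ![U, V, W, M.J X, Y, Z] := by
    ext i; fin_cases i <;> rfl
  have h4 : Function.update ![U, V, W, X, Y, Z] 4 (M.J Y) = ![U, V, W, X, M.J Y, Z] := by
    ext i; fin_cases i <;> rfl
  have h5 : Function.update ![U, V, W, X, Y, Z] 5 (M.J Z) = ![U, V, W, X, Y, M.J Z] := by
    ext i; fin_cases i <;> rfl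
  have h' : M.vol6 ![M.J U, V, W, X, Y, Z] + M.vol6 ![U, M.J V, W, X, Y, Z]
      + M.vol6 ![U, V, M.J W, X, Y, Z] + M.vol6 ![U, V, W, M.J X, Y, Z]
      + M.vol6 ![U, V, W, X, M.J Y, Z] + M.vol6 ![U, V, W, X, Y, M.J Z] = 0 := by
    rw [← h0, ← h1, ← h2, ← h3, ← h4, ← h5]
    exact h
  linear_combination h'

theorem IsType30.star3_derivation_J (hα : M.IsType30 α) (X Y Z : M.V) :
    M.star3 α (M.J X) Y Z + M.star3 α X (M.J Y) Z + M.star3 α X Y (M.J Z) =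
      3 * M.star3 (fun X Y Z => α (M.J X) Y Z) X Y Z := by
  have hv₁ (U V W : M.V) : IsLinearMap M.F fun U => M.vol6 ![U, V, W, X, Y, Z] := by
    have h (T : M.V) : ![T, V, W, X, Y, Z] = Function.update ![U, V, W, X, Y, Z] 0 T := by
      ext i; fin_cases i <;> rfl
    simpa only [← h] using vol6_isLinear ![U, V, W, X, Y, Z] 0
  have hv₂ (U V W : M.V) : IsLinearMap M.F fun V => M.vol6 ![U, V, W, X, Y, Z] := by
    have h (T : M.V) : ![U, T, W, X, Y, Z] = Function.update ![U, V, W, X, Y, Z] 1 T := by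
      ext i; fin_cases i <;> rfl
    simpa only [← h] using vol6_isLinear ![U, V, W, X, Y, Z] 1
  have hv₃ (U V W : M.V) : IsLinearMap M.F fun W => M.vol6 ![U, V, W, X, Y, Z] := by
    have h (T : M.V) : ![U, V, T, X, Y, Z] = Function.update ![U, V, W, X, Y, Z] 2 T := by
      ext i; fin_cases i <;> rfl
    simpa only [← h] using vol6_isLinear ![U, V, W, X, Y, Z] 2
  have k₁ (j k : Fin 6) : ∑ i, α (M.e i) (M.e j) (M.e k) *
      M.vol6 ![M.J (M.e i), M.e j, M.e k, X, Y, Z] = -∑ i, α (M.J (M.e i)) (M.e j) (M.e k) *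
      M.vol6 ![M.e i, M.e j, M.e k, X, Y, Z] := by
    rw [frame_J (B := fun U V => α U (M.e j) (M.e k) * M.vol6 ![V, M.e j, M.e k, X, Y, Z])
      (fun V => isLinear_mul_const (hα.1.isLinear₁ _ _) _)
      fun U => isLinear_const_mul (hv₁ 0 _ _) _, neg_neg]
  have k₂ (i k : Fin 6) : ∑ j, α (M.e i) (M.e j) (M.e k) *
      M.vol6 ![M.e i, M.J (M.e j), M.e k, X, Y, Z] = -∑ j, α (M.J (M.e i)) (M.e j) (M.e k) *
      M.vol6 ![M.e i, M.e j, M.e k, X, Y, Z] := by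
    simp_rw [← hα.J₂]
    rw [frame_J (B := fun U V => α (M.e i) U (M.e k) * M.vol6 ![M.e i, V, M.e k, X, Y, Z])
      (fun V => isLinear_mul_const (hα.1.isLinear₂ _ _) _)
      fun U => isLinear_const_mul (hv₂ _ 0 _) _, neg_neg]
  have k₃ (i j : Fin 6) : ∑ k, α (M.e i) (M.e j) (M.e k) *
      M.vol6 ![M.e i, M.e j, M.J (M.e k), X, Y, Z] = -∑ k, α (M.J (M.e i)) (M.e j) (M.e k) *
      M.vol6 ![M.e i, M.e j, M.e k, X, Y, Z] := by
    simp_rw [← hα.J₃]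
    rw [frame_J (B := fun U V => α (M.e i) (M.e j) U * M.vol6 ![M.e i, M.e j, V, X, Y, Z])
      (fun V => isLinear_mul_const (hα.1.isLinear₃ _ _) _)
      fun U => isLinear_const_mul (hv₃ _ _ 0) _, neg_neg]
  have l₁ : ∑ i, ∑ j, ∑ k, α (M.e i) (M.e j) (M.e k) *
      M.vol6 ![M.J (M.e i), M.e j, M.e k, X, Y, Z] =
      -∑ i, ∑ j, ∑ k, α (M.J (M.e i)) (M.e j) (M.e k) *
      M.vol6 ![M.e i, M.e j, M.e k, X, Y, Z] := by
    rw [Finset.sum_comm, Finset.sum_congr rfl fun j _ => Finset.sum_comm,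
      Finset.sum_comm (f := fun i j => ∑ k, α (M.J _) _ _ * _), ← Finset.sum_neg_distrib]
    refine Finset.sum_congr rfl fun j _ => ?_
    rw [Finset.sum_comm (f := fun i k => α (M.J _) _ _ * _), ← Finset.sum_neg_distrib]
    exact Finset.sum_congr rfl fun k _ => k₁ j k
  have l₂ : ∑ i, ∑ j, ∑ k, α (M.e i) (M.e j) (M.e k) *
      M.vol6 ![M.e i, M.J (M.e j), M.e k, X, Y, Z] =
      -∑ i, ∑ j, ∑ k, α (M.J (M.e i)) (M.e j) (M.e k) *
      M.vol6 ![M.e i, M.e j, M.e k, X, Y, Z] := by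
    rw [← Finset.sum_neg_distrib]
    refine Finset.sum_congr rfl fun i _ => ?_
    rw [Finset.sum_comm, Finset.sum_comm (f := fun j k => α (M.J _) _ _ * _),
      ← Finset.sum_neg_distrib]
    exact Finset.sum_congr rfl fun k _ => k₂ i k
  have l₃ : ∑ i, ∑ j, ∑ k, α (M.e i) (M.e j) (M.e k) *
      M.vol6 ![M.e i, M.e j, M.J (M.e k), X, Y, Z] =
      -∑ i, ∑ j, ∑ k, α (M.J (M.e i)) (M.e j) (M.e k) *
      M.vol6 ![M.e i, M.e j, M.e k, X, Y, Z] := by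
    simp only [← Finset.sum_neg_distrib]
    refine Finset.sum_congr rfl fun i _ => Finset.sum_congr rfl fun j _ => ?_
    rw [k₃, Finset.sum_neg_distrib]
  unfold star3
  rw [mul_smul_comm, ← smul_add, ← smul_add]
  congr 1
  simp_rw [← Finset.sum_add_distrib, ← mul_add, vol6_derivation_J, mul_neg, mul_add,
    Finset.sum_neg_distrib, Finset.sum_add_distrib]
  rw [l₁, l₂, l₃]
  ring

/-- The Hodge star preserves real parts of `(3,0)`-forms. -/
theorem IsType30.star3 (hα : M.IsType30 α) : M.IsType30 (M.star3 α) := by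
  have hβ := star3_isForm3 α
  set β := M.star3 α with hβ'
  have hneg : M.star3 (fun X Y Z => α (M.J (M.J X)) Y Z) = fun X Y Z => -β X Y Z := by
    funext X Y Z
    simp only [M.J_sq, (hα.1.isLinear₁ _ _).map_neg, hβ', NK6.star3, neg_mul,
      Finset.sum_neg_distrib, smul_neg]
  have hD₁ := hα.star3_derivation_J
  have hD₂ := hα.comp_J.star3_derivation_J
  rw [hneg] at hD₂
  have hn₁ (X Y Z) : β (-X) Y Z = -β X Y Z := (hβ.isLinear₁ Y Z).map_neg X
  have hn₂ (X Y Z) : β X (-Y) Z = -β X Y Z := (hβ.isLinear₂ X Z).map_neg Y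
  have hn₃ (X Y Z) : β X Y (-Z) = -β X Y Z := (hβ.isLinear₃ X Y).map_neg Z
  have h (X Y Z : M.V) :
      β (M.J X) (M.J Y) Z + β (M.J X) Y (M.J Z) + β X (M.J Y) (M.J Z) + 3 * β X Y Z = 0 := by
    have h₁ := hD₁ (M.J X) Y Z
    have h₂ := hD₁ X (M.J Y) Z
    have h₃ := hD₁ X Y (M.J Z)
    simp only [M.J_sq, ← hβ', hn₁, hn₂, hn₃] at h₁ h₂ h₃
    refine eq_zero_of_natCast_mul_eq_zero two_ne_zero ?_
    push_cast
    linear_combination h₁ + h₂ + h₃ + 3 * hD₂ X Y Z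
  have hJJ (X Y Z : M.V) : β (M.J X) (M.J Y) Z + β X Y Z = 0 := by
    have h' := h (M.J X) (M.J Y) Z
    simp only [M.J_sq, hn₁, hn₂, neg_neg] at h'
    refine eq_zero_of_natCast_mul_eq_zero four_ne_zero ?_
    push_cast
    linear_combination h X Y Z + h'
  refine ⟨hβ, fun X Y Z => ?_⟩
  have h' := hJJ X (M.J Y) Z
  rw [M.J_sq, hn₂] at h'
  linear_combination -h'

theorem psiM_isType30 : M.IsType30 M.psiM := psiP_isType30.star3

end NK6

namespace NK6

variable {M : NK6}

section Form2

variable {w : M.V → M.V → M.F}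

theorem IsForm2.isLinear₁ (hw : M.IsForm2 w) (Y : M.V) : IsLinearMap M.F fun X => w X Y := by
  have h0 : w 0 Y = 0 := by simpa using hw.1 1 0 0 Y
  exact ⟨fun X X' => by simpa using hw.1 1 X X' Y, fun f X => by simpa [h0] using hw.1 f X 0 Y⟩

theorem IsForm2.isLinear₂ (hw : M.IsForm2 w) (X : M.V) : IsLinearMap M.F (w X) := by
  rw [show w X = fun Y => -w Y X from funext fun Y => hw.2 X Y]
  exact (-(hw.isLinear₁ X).mk').isLinear

theorem IsForm2.self (hw : M.IsForm2 w) (X : M.V) : w X X = 0 :=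
  eq_zero_of_natCast_mul_eq_zero two_ne_zero (by push_cast; linear_combination hw.2 X X)

theorem IsForm2.isLinear_comp_A (hw : M.IsForm2 w) (X Y : M.V) :
    IsLinearMap M.F fun Z => w X (M.A Y Z) :=
  ⟨fun Z Z' => by rw [(A_isLinear_right Y).map_add, (hw.isLinear₂ X).map_add],
    fun f Z => by rw [(A_isLinear_right Y).map_smul, (hw.isLinear₂ X).map_smul]⟩

theorem g_toEnd (hw : M.IsForm2 w) (X Y : M.V) : M.g (M.toEnd w X) Y = w X Y := by
  rw [toEnd, ← (g_isLinear_left Y).mk'_apply, map_sum, ← frame_contract (hw.isLinear₂ X) Y]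
  refine Finset.sum_congr rfl fun i _ => ?_
  rw [map_smul, (g_isLinear_left Y).mk'_apply, smul_eq_mul, smul_eq_mul, mul_comm, M.g_symm]

theorem Is11.J_comm (hw : M.Is11 w) (X Y : M.V) : w (M.J X) Y = -w X (M.J Y) := by
  rw [← hw.2 X, M.J_sq, (hw.1.isLinear₂ _).map_neg, neg_neg]

theorem wedge_A_eq_zero (hw : M.IsPrim11 w) (X Y Z : M.V) :
    w (M.A X Y) Z + w (M.A Y Z) X + w (M.A Z X) Y = 0 := by
  obtain ⟨hw, htr⟩ := hw
  have hg (V W : M.V) : M.g W (M.toEnd w V) = w V W := by rw [M.g_symm, g_toEnd hw.1]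
  have h (U V W : M.V) : M.g (M.A (M.toEnd w W) U) V = -w (M.A U V) W := by
    rw [A_isType30.1.cycle, hg, hw.1.2]
  have hz := A_isType30.derivation_eq_zero (S := M.toEnd w)
    ⟨fun X Y => g_ext fun Z => by
      rw [g_toEnd hw.1, M.g_add₁, g_toEnd hw.1, g_toEnd hw.1, (hw.1.isLinear₁ Z).map_add],
      fun f X => g_ext fun Z => by
      rw [g_toEnd hw.1, M.g_smul₁, g_toEnd hw.1, (hw.1.isLinear₁ Z).map_smul, smul_eq_mul]⟩
    (fun X => g_ext fun Z => by rw [g_toEnd hw.1, g_J_left, g_toEnd hw.1, hw.J_comm])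
    (by simp_rw [hg, hw.1.self, Finset.sum_const_zero]) (by simp_rw [hg, htr]) X Y Z
  simp only [h] at hz
  rw [A_swap X Z, (hw.1.isLinear₁ Y).map_neg] at hz
  linear_combination -hz

theorem sum_wedge_eAct2_A (hw : M.IsPrim11 w) (X Y Z : M.V) :
    ∑ i, M.wedge12 (fun W => M.g (M.e i) W) (M.eAct2 (M.A (M.e i)) w) X Y Z = 0 := by
  have hl (Y Z : M.V) : IsLinearMap M.F fun X => M.eAct2 (M.A X) w Y Z := by
    constructor <;> intros <;>
    simp only [eAct2, (A_isLinear_left _).map_add, (A_isLinear_left _).map_smul,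
      (hw.1.1.isLinear₁ _).map_add, (hw.1.1.isLinear₂ _).map_add,
      (hw.1.1.isLinear₁ _).map_smul, (hw.1.1.isLinear₂ _).map_smul, smul_eq_mul] <;>
    ring
  have h (X Y Z : M.V) :
      ∑ i, M.g (M.e i) X * M.eAct2 (M.A (M.e i)) w Y Z = M.eAct2 (M.A X) w Y Z := by
    simpa only [smul_eq_mul, M.g_symm X] using frame_contract (hl Y Z) X
  simp only [wedge12, Finset.sum_add_distrib, Finset.sum_sub_distrib, h]
  simp only [eAct2]
  rw [hw.1.1.2 Y (M.A X Z), hw.1.1.2 X (M.A Y Z), hw.1.1.2 X (M.A Z Y), A_swap X Z, A_swap Y X,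
    A_swap Z Y]
  simp only [(hw.1.1.isLinear₁ _).map_neg]
  linear_combination -2 * wedge_A_eq_zero hw X Y Z

theorem sum_contract_eAct2_A (hw : M.IsPrim11 w) (Y : M.V) :
    ∑ i, M.eAct2 (M.A (M.e i)) w (M.e i) Y = 0 := by
  obtain ⟨hw, -⟩ := hw
  have h := frame_J_J (B := fun U V => w U (M.A Y V)) (fun V => hw.1.isLinear₁ _)
    (fun U => hw.1.isLinear_comp_A U Y)
  simp_rw [A_J_right, (hw.1.isLinear₂ _).map_neg, hw.2, Finset.sum_neg_distrib] at h
  have h0 := (hw.1.isLinear₁ Y).map_zero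
  simp_rw [eAct2, A_self, h0, A_swap (M.e _) Y, (hw.1.isLinear₂ _).map_neg, neg_zero, zero_sub,
    neg_neg]
  exact eq_zero_of_natCast_mul_eq_zero two_ne_zero (by push_cast; linear_combination -h)

end Form2

/-- The contraction of the skew form `A` with a symmetric endomorphism vanishes. -/
theorem sum_commE_A {S : M.V → M.V} (hS : M.IsSymEnd S) :
    ∑ i, M.commE (M.A (M.e i)) S (M.e i) = 0 := by
  obtain ⟨⟨hadd, hsmul⟩, hsym⟩ := hS
  have hS0 : S 0 = 0 := by simpa using hsmul 0 0
  refine M.g_nondeg _ fun Z => ?_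
  rw [← (g_isLinear_left Z).mk'_apply, map_sum]
  simp only [commE, A_self, hS0, sub_zero, IsLinearMap.mk'_apply]
  have h := frame_transpose (B := fun U V => M.g (M.A U V) Z)
    (fun V => A_isType30.1.isLinear₁ V Z) (fun U => A_isType30.1.isLinear₂ U Z) hsym
  simp_rw [A_isType30.1.swap₁₂ (S _), Finset.sum_neg_distrib] at h
  exact eq_zero_of_natCast_mul_eq_zero two_ne_zero (by push_cast; linear_combination -h)

theorem sum_contract_eAct3_A {S : M.V → M.V} (hS : M.IsSymMinus S) (Y Z : M.V) :
    ∑ i, M.eAct3 (M.A (M.e i)) (M.eAct3 S M.psiM) (M.e i) Y Z = 0 := by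
  have hψ := psiM_isType30 (M := M)
  have hP := A_isType30 (M := M)
  have hK := hP.contr_symMinus_comm hψ hS Y Z
  obtain ⟨⟨⟨hadd, hsmul⟩, hsym⟩, hJ⟩ := hS
  set σ := M.eAct3 S M.psiM with hσ
  have hσ_cycle (X Y Z : M.V) : σ X Y Z = σ Y Z X := by
    simp only [hσ, eAct3]
    rw [hψ.1.cycle (S X), hψ.1.cycle X, hψ.1.cycle X]
    ring
  have hσ_swap (X Y Z : M.V) : σ X Y Z = -σ X Z Y := by
    simp only [hσ, eAct3]
    rw [hψ.1.swap₂₃ (S X), hψ.1.swap₂₃ X (S Y), hψ.1.swap₂₃ X Y]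
    ring
  have hσl (X Z : M.V) : IsLinearMap M.F fun Y => σ X Y Z := by
    constructor <;> intros <;>
    simp only [hσ, eAct3, hadd, hsmul, (hψ.1.isLinear₂ _ _).map_add,
      (hψ.1.isLinear₂ _ _).map_smul, smul_eq_mul] <;>
    ring
  have hσ0 (Y Z : M.V) : σ 0 Y Z = 0 := by
    rw [← hσ_cycle Z]; exact (hσl _ _).map_zero
  have hQ (Y Z : M.V) : ∑ i, σ (M.e i) (M.A (M.e i) Y) Z =
      2 * (∑ i, ∑ j, M.g (M.A Y (M.e i)) (M.e j) * M.psiM Z (S (M.e i)) (M.e j)) +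
        IsType30.contr₂ (fun X Y Z => M.g (M.A X Y) Z) M.psiM Y (S Z) := by
    have h₁ (i : Fin 6) : σ (M.e i) (M.A (M.e i) Y) Z =
        -∑ j, M.g (M.A Y (M.e i)) (M.e j) * σ (M.e i) (M.e j) Z := by
      have h := frame_contract (hσl (M.e i) Z) (M.A Y (M.e i))
      rw [A_swap, (hσl _ _).map_neg, ← h]
      rfl
    have h₂ : ∑ i, ∑ j, M.g (M.A Y (M.e i)) (M.e j) * M.psiM (M.e i) (S (M.e j)) Z =
        ∑ i, ∑ j, M.g (M.A Y (M.e i)) (M.e j) * M.psiM Z (S (M.e i)) (M.e j) := by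
      rw [Finset.sum_comm]
      refine Finset.sum_congr rfl fun i _ => Finset.sum_congr rfl fun j _ => ?_
      have h := hP.1.swap₂₃ Y (M.e j) (M.e i)
      rw [h, ← hψ.1.cycle Z, hψ.1.swap₂₃ Z]
      ring
    simp only [h₁]
    simp only [hσ, eAct3, mul_sub, mul_neg, Finset.sum_sub_distrib, Finset.sum_neg_distrib]
    rw [h₂]
    simp only [← fun X Y => hψ.1.cycle Z X Y, IsType30.contr₂, ← fun X Y => hψ.1.cycle (S Z) X Y]
    ring
  have hH : IsType30.contr₂ (fun X Y Z => M.g (M.A X Y) Z) M.psiM Y (S Z) =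
      IsType30.contr₂ (fun X Y Z => M.g (M.A X Y) Z) M.psiM Z (S Y) := by
    refine sub_eq_zero.1 (eq_zero_of_natCast_mul_eq_zero (n := 6) (by norm_num) ?_)
    push_cast
    have h₁ : M.g (S Z) Y = M.g (S Y) Z := by rw [hsym, M.g_symm]
    have h₂ : M.g (M.J (S Z)) Y = M.g (M.J (S Y)) Z := by
      rw [g_J_left, hsym, hJ, (g_isLinear_right Z).map_neg, neg_neg, M.g_symm]
    rw [mul_sub, hP.contr₂_eq hψ, hP.contr₂_eq hψ, h₁, h₂, sub_self]
  have h (i : Fin 6) : M.eAct3 (M.A (M.e i)) σ (M.e i) Y Z =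
      σ (M.e i) (M.A (M.e i) Z) Y - σ (M.e i) (M.A (M.e i) Y) Z := by
    rw [eAct3, A_self, hσ0, hσ_swap _ Y]
    ring
  simp_rw [h, Finset.sum_sub_distrib, hQ, hH, hK]
  ring

end NK6

/-- The Schur-lemma relations for the natural action of `A_X = J(∇_X J)`:
(i) `∑ᵢ eᵢ ∧ (A_{eᵢ⋆}w) = 0` and (ii) `∑ᵢ eᵢ ⌟ (A_{eᵢ⋆}w) = 0` for primitive
`(1,1)`-forms `w`; (iii) `∑ᵢ (A_{eᵢ⋆}h)(eᵢ) = 0` for `h ∈ Sym⁺₀M`;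
(iv) `∑ᵢ (A_{eᵢ⋆}S)(eᵢ) = 0` and (v) `∑ᵢ eᵢ ⌟ (A_{eᵢ⋆}(S⋆ψ⁻)) = 0` for `S ∈ Sym⁻M`. -/
theorem schur_relations (M : NK6) (hscal : M.scal = 30) :
    (∀ w, M.IsPrim11 w → ∀ X Y Z : M.V,
      ∑ i, M.wedge12 (fun W => M.g (M.e i) W) (M.eAct2 (M.A (M.e i)) w) X Y Z = 0) ∧
    (∀ w, M.IsPrim11 w → ∀ Y : M.V,
      ∑ i, M.eAct2 (M.A (M.e i)) w (M.e i) Y = 0) ∧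
    (∀ h, M.IsSymPlus0 h → ∑ i, M.commE (M.A (M.e i)) h (M.e i) = 0) ∧
    (∀ Sm, M.IsSymMinus Sm → ∑ i, M.commE (M.A (M.e i)) Sm (M.e i) = 0) ∧
    (∀ Sm, M.IsSymMinus Sm → ∀ Y Z : M.V,
      ∑ i, M.eAct3 (M.A (M.e i)) (M.eAct3 Sm M.psiM) (M.e i) Y Z = 0) :=
  ⟨fun _ hw => NK6.sum_wedge_eAct2_A hw, fun _ hw => NK6.sum_contract_eAct2_A hw,
    fun _ hh => NK6.sum_commE_A hh.1.1, fun _ hS => NK6.sum_commE_A hS.1,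
    fun _ hS => NK6.sum_contract_eAct3_A hS⟩
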